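/- arXiv:2503.01023 — 2 statements merged into one kernel-verified Lean document; each statement's English description precedes it below -/
import Mathlib

section
/- For every integer n ≥ 0, the number T(n) of ternary trees with exactly n internal vertices equals (1/(2n+1))·binom(3n, n); equivalently, (2n+1)·T(n) = binom(3n, n). In particular T(n) = A(n+1), the number of (n+1)-noncrossing trees. -/
/-- The noncrossing condition for a graph on the vertex set `ZMod n`
(vertex `j ∈ {1,…,n}` of the paper corresponds to `j - 1 : ZMod n`):
no two edges `{a,b}` and `{c,d}` satisfy `a < c < b < d`. -/
def Noncrossing {n : ℕ} (G : SimpleGraph (ZMod n)) : Prop :=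
  ∀ a b c d : ZMod n, G.Adj a b → G.Adj c d →
    ¬(a.val < c.val ∧ c.val < b.val ∧ b.val < d.val)

/-- An `n`-noncrossing tree: a tree on `n` vertices, drawn on the circle, with no crossing edges. -/
def IsNCTree {n : ℕ} (G : SimpleGraph (ZMod n)) : Prop :=
  G.IsTree ∧ Noncrossing G

/-- `A n` is the number of `n`-noncrossing trees. -/
noncomputable def A (n : ℕ) : ℕ :=
  Nat.card {G : SimpleGraph (ZMod n) // IsNCTree G}

/-- `A₁ n` is the number of `n`-noncrossing trees where vertex `1`
(i.e. `0 : ZMod n`) has degree `1`. -/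
noncomputable def A₁ (n : ℕ) : ℕ :=
  Nat.card {G : SimpleGraph (ZMod n) // IsNCTree G ∧ (G.neighborSet 0).ncard = 1}

/-- Ternary trees: each vertex is either a leaf or has exactly three ordered children. -/
inductive TernaryTree : Type
  | leaf : TernaryTree
  | node : TernaryTree → TernaryTree → TernaryTree → TernaryTree

/-- The number of internal vertices (vertices with three children) of a ternary tree. -/
def TernaryTree.internals : TernaryTree → ℕ
  | .leaf => 0
  | .node a b c => a.internals + b.internals + c.internals + 1

/-- `T n` is the number of ternary trees with exactly `n` internal vertices. -/
noncomputable def T (n : ℕ) : ℕ :=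
  Nat.card {t : TernaryTree // t.internals = n}

namespace TernaryTree

/-- Lists of `k` ternary trees with `n` internal vertices in total. -/
def Forest (n k : ℕ) : Type :=
  {l : List TernaryTree // l.length = k ∧ (l.map internals).sum = n}

/-- A nonempty forest without internal vertices starts with a leaf. -/
def forestZeroEquiv (k : ℕ) : Forest 0 (k + 1) ≃ Forest 0 k where
  toFun
    | ⟨[], h⟩ => absurd h.1 (by simp)
    | ⟨.leaf :: l, h⟩ => ⟨l, by simpa [internals] using h⟩
    | ⟨.node a b c :: l, h⟩ => absurd h.2 (by simp [internals])
  invFun l := ⟨.leaf :: l.1, by simpa [internals] using l.2⟩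
  left_inv
    | ⟨[], h⟩ => absurd h.1 (by simp)
    | ⟨.leaf :: l, h⟩ => rfl
    | ⟨.node a b c :: l, h⟩ => absurd h.2 (by simp [internals])
  right_inv _ := rfl

/-- The first tree of a nonempty forest is a leaf, or splits into three subtrees. -/
def forestSuccEquiv (n k : ℕ) : Forest (n + 1) (k + 1) ≃ Forest (n + 1) k ⊕ Forest n (k + 3) where
  toFun
    | ⟨[], h⟩ => absurd h.1 (by simp)
    | ⟨.leaf :: l, h⟩ => .inl ⟨l, by simpa [internals] using h⟩
    | ⟨.node a b c :: l, h⟩ => .inr ⟨a :: b :: c :: l, by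
        simp [internals] at h ⊢; omega⟩
  invFun
    | .inl l => ⟨.leaf :: l.1, by simpa [internals] using l.2⟩
    | .inr ⟨[], h⟩ => absurd h.1 (by simp)
    | .inr ⟨[_], h⟩ => absurd h.1 (by simp)
    | .inr ⟨[_, _], h⟩ => absurd h.1 (by simp)
    | .inr ⟨a :: b :: c :: l, h⟩ => ⟨.node a b c :: l, by
        simp [internals] at h ⊢; omega⟩
  left_inv
    | ⟨[], h⟩ => absurd h.1 (by simp)
    | ⟨.leaf :: l, h⟩ => rfl
    | ⟨.node a b c :: l, h⟩ => rfl
  right_inv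
    | .inl l => rfl
    | .inr ⟨[], h⟩ => absurd h.1 (by simp)
    | .inr ⟨[_], h⟩ => absurd h.1 (by simp)
    | .inr ⟨[_, _], h⟩ => absurd h.1 (by simp)
    | .inr ⟨a :: b :: c :: l, h⟩ => rfl

instance (n : ℕ) : IsEmpty (Forest (n + 1) 0) :=
  ⟨fun ⟨l, h₁, h₂⟩ => by simp [List.length_eq_zero_iff.mp h₁] at h₂⟩

instance : Unique (Forest 0 0) where
  default := ⟨[], by simp⟩
  uniq l := Subtype.ext (List.length_eq_zero_iff.mp l.2.1)

theorem finite_forest (n k : ℕ) : Finite (Forest n k) := by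
  induction n generalizing k with
  | zero =>
    induction k with
    | zero => infer_instance
    | succ k ih => exact .of_equiv _ (forestZeroEquiv k).symm
  | succ n ihn =>
    induction k with
    | zero => infer_instance
    | succ k ih =>
      have := ihn (k + 3)
      exact .of_equiv _ (forestSuccEquiv n k).symm

theorem card_forest (n k : ℕ) :
    (3 * n + k) * Nat.card (Forest n k) = k * (3 * n + k).choose n := by
  induction n generalizing k with
  | zero =>
    have h : Nat.card (Forest 0 k) = 1 := by
      induction k with
      | zero => exact Nat.card_unique
      | succ k ih => rw [Nat.card_congr (forestZeroEquiv k), ih]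
    simp [h]
  | succ n ihn =>
    induction k with
    | zero => simp
    | succ k ih =>
      have := finite_forest (n + 1) k
      have := finite_forest n (k + 3)
      rw [Nat.card_congr (forestSuccEquiv n k), Nat.card_sum]
      have hn := ihn (k + 3)
      have hc := Nat.choose_succ_right_eq (3 * n + k + 3) n
      rw [show 3 * n + k + 3 - n = 2 * n + k + 3 by omega] at hc
      rw [show 3 * (n + 1) + (k + 1) = 3 * n + k + 3 + 1 by ring, Nat.choose_succ_succ']
      rw [show 3 * (n + 1) + k = 3 * n + k + 3 by ring] at ih
      rw [show 3 * n + (k + 3) = 3 * n + k + 3 by ring] at hn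
      generalize (3 * n + k + 3).choose (n + 1) = x at *
      generalize (3 * n + k + 3).choose n = y at *
      apply Nat.eq_of_mul_eq_mul_left (show 0 < 3 * n + k + 3 by omega)
      zify at *
      linear_combination (3 * n + k + 4 : ℤ) * (ih + hn) - 3 * hc

/-- A ternary tree is a forest with one component. -/
def singletonEquiv (n : ℕ) : {t : TernaryTree // t.internals = n} ≃ Forest n 1 where
  toFun t := ⟨[t.1], by simpa using t.2⟩
  invFun
    | ⟨[], h⟩ => absurd h.1 (by simp)
    | ⟨[t], h⟩ => ⟨t, by simpa using h⟩
    | ⟨_ :: _ :: _, h⟩ => absurd h.1 (by simp)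
  left_inv _ := rfl
  right_inv
    | ⟨[], h⟩ => absurd h.1 (by simp)
    | ⟨[t], h⟩ => rfl
    | ⟨_ :: _ :: _, h⟩ => absurd h.1 (by simp)

theorem two_mul_add_one_mul_T (n : ℕ) : (2 * n + 1) * T n = (3 * n).choose n := by
  have h : (3 * n + 1) * T n = 1 * (3 * n + 1).choose n := by
    rw [← card_forest, T, Nat.card_congr (singletonEquiv n)]
  have hc := Nat.choose_mul_succ_eq (3 * n) n
  rw [show 3 * n + 1 - n = 2 * n + 1 by omega] at hc
  apply Nat.eq_of_mul_eq_mul_left (show 0 < 3 * n + 1 by omega)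
  linear_combination (2 * n + 1) * h - hc

/-- The edges `u < v` of the noncrossing tree on `[s, s + t.internals]` encoded by `t`. In
`node a b c`, the longest edge at `s` joins the trees of `a` and `b`, and its other end is the
last vertex of the tree of `b` and the first one of the tree of `c`. -/
def Edge (s : ℕ) : TernaryTree → ℕ → ℕ → Prop
  | .leaf, _, _ => False
  | .node a b c, u, v => a.Edge s u v ∨ b.Edge (s + a.internals + 1) u v ∨
      c.Edge (s + a.internals + 1 + b.internals) u v ∨
      (u = s ∧ v = s + a.internals + 1 + b.internals)

end TernaryTree

open TernaryTree

/-- `R` is the relation saying that `u < v` are joined by an edge of a noncrossing tree on the integers in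
`[a, b]`. Connectedness and acyclicity are expressed by cuts. -/
structure IsNCTreeRel (R : ℕ → ℕ → Prop) (a b : ℕ) : Prop where
  bounds : ∀ u v, R u v → a ≤ u ∧ u < v ∧ v ≤ b
  noncrossing : ∀ u v w x, R u v → R w x → ¬(u < w ∧ w < v ∧ v < x)
  connected : ∀ P : ℕ → Prop, (∀ u v, R u v → (P u ↔ P v)) → ∀ x, a ≤ x → x ≤ b → (P a ↔ P x)
  acyclic : ∀ u v, R u v → ∃ P : ℕ → Prop, P u ∧ ¬P v ∧
    ∀ x y, R x y → ¬(x = u ∧ y = v) → (P x ↔ P y)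

namespace TernaryTree

theorem isNCTreeRel_edge (t : TernaryTree) (s : ℕ) :
    IsNCTreeRel (t.Edge s) s (s + t.internals) := by
  induction t generalizing s with
  | leaf =>
    refine ⟨by simp [Edge], by simp [Edge], fun P _ x h₁ h₂ => ?_, by simp [Edge]⟩
    rw [show s = x by simp [internals] at h₂; omega]
  | node a b c iha ihb ihc =>
    specialize iha s
    specialize ihb (s + a.internals + 1)
    specialize ihc (s + a.internals + 1 + b.internals)
    simp only [Edge, internals]
    have ba := iha.bounds
    have bb := ihb.bounds
    have bc := ihc.bounds
    generalize hi : s + a.internals = i at *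
    generalize hj : i + 1 + b.internals = j at *
    rw [show s + (a.internals + b.internals + c.internals + 1) = j + c.internals by omega]
    generalize hn : j + c.internals = n at *
    refine ⟨?_, ?_, ?_, ?_⟩
    · grind
    · rintro u v w x (h | h | h | h) (h' | h' | h' | h')
      · exact iha.noncrossing _ _ _ _ h h'
      all_goals first
        | exact ihb.noncrossing _ _ _ _ h h'
        | exact ihc.noncrossing _ _ _ _ h h'
        | grind
    · intro P hP x hx hx'
      have ca := iha.connected P (by grind)
      have cb := ihb.connected P (by grind)
      have cc := ihc.connected P (by grind)
      have root : P s ↔ P j := hP _ _ (by simp)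
      have hbj := cb j (by omega) le_rfl
      rcases le_or_gt x i with h | h
      · exact ca x hx h
      rcases le_or_gt x j with h' | h'
      · rw [root, ← hbj]; exact cb x h h'
      · rw [root]; exact cc x h'.le hx'
    · rintro u v (h | h | h | ⟨rfl, rfl⟩)
      · obtain ⟨P, hu, hv, hP⟩ := iha.acyclic u v h
        exact ⟨fun x => if x ≤ i then P x else P s, by grind, by grind, by grind⟩
      · obtain ⟨P, hu, hv, hP⟩ := ihb.acyclic u v h
        exact ⟨fun x => if i < x ∧ x ≤ j then P x else P j, by grind, by grind, by grind⟩
      · obtain ⟨P, hu, hv, hP⟩ := ihc.acyclic u v h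
        exact ⟨fun x => if j ≤ x then P x else P j, by grind, by grind, by grind⟩
      · exact ⟨fun x => x ≤ i, by grind, by grind, by grind⟩

theorem exists_edge_over (t : TernaryTree) (s k : ℕ) (h : s ≤ k) (h' : k < s + t.internals) :
    ∃ u v, t.Edge s u v ∧ u ≤ k ∧ k < v := by
  induction t generalizing s with
  | leaf => simp [internals] at h'; omega
  | node a b c iha ihb ihc =>
    simp only [internals] at h'
    rcases lt_or_ge k (s + a.internals + 1 + b.internals) with hk | hk
    · exact ⟨s, _, .inr (.inr (.inr ⟨rfl, rfl⟩)), h, hk⟩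
    · obtain ⟨u, v, huv, hu⟩ := ihc _ hk (by omega)
      exact ⟨u, v, .inr (.inr (.inl huv)), hu⟩

theorem eq_of_edge_iff {t t' : TernaryTree} {s : ℕ} (h : t.internals = t'.internals)
    (hE : ∀ u v, t.Edge s u v ↔ t'.Edge s u v) : t = t' := by
  induction t generalizing s t' with
  | leaf =>
    cases t' with
    | leaf => rfl
    | node => simp [internals] at h
  | node a b c iha ihb ihc =>
    cases t' with
    | leaf => simp [internals] at h
    | node a' b' c' =>
      simp only [internals, Edge] at h hE
      have ba := (isNCTreeRel_edge a s).bounds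
      have bb := (isNCTreeRel_edge b (s + a.internals + 1)).bounds
      have bc := (isNCTreeRel_edge c (s + a.internals + 1 + b.internals)).bounds
      have ba' := (isNCTreeRel_edge a' s).bounds
      have bb' := (isNCTreeRel_edge b' (s + a'.internals + 1)).bounds
      have bc' := (isNCTreeRel_edge c' (s + a'.internals + 1 + b'.internals)).bounds
      have hj : a.internals + b.internals = a'.internals + b'.internals := by
        have h₁ := (hE s _).mp (.inr (.inr (.inr ⟨rfl, rfl⟩)))
        have h₂ := (hE s _).mpr (.inr (.inr (.inr ⟨rfl, rfl⟩)))
        grind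
      have ha : a.internals = a'.internals := by
        rcases lt_trichotomy a.internals a'.internals with hlt | heq | hlt
        · obtain ⟨u, v, huv, hu⟩ :=
            exists_edge_over a' s (s + a.internals) (by omega) (by omega)
          have := (hE u v).mpr (.inl huv)
          grind
        · exact heq
        · obtain ⟨u, v, huv, hu⟩ :=
            exists_edge_over a s (s + a'.internals) (by omega) (by omega)
          have := (hE u v).mp (.inl huv)
          grind
      have hb : b.internals = b'.internals := by omega
      have hc : c.internals = c'.internals := by omega
      rw [← ha, ← hb] at hE bc'
      rw [← ha] at bb'
      rw [iha ha (s := s) (by grind), ihb hb (s := s + a.internals + 1) (by grind),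
        ihc hc (s := s + a.internals + 1 + b.internals) (by grind)]

end TernaryTree

namespace IsNCTreeRel

variable {R : ℕ → ℕ → Prop} {a b : ℕ}

/-- The neighbor of `a` furthest from it. -/
theorem exists_max_neighbor (hR : IsNCTreeRel R a b) (hab : a < b) :
    ∃ j, R a j ∧ ∀ v, R a v → v ≤ j := by
  classical
  have hex : ∃ v, R a v := by
    by_contra! hno
    have := hR.connected (fun x => x = a)
      (fun u v huv => by have := hR.bounds u v huv; grind) b hab.le le_rfl
    grind
  obtain ⟨v, hv⟩ := hex
  have hb : v ≤ b := (hR.bounds _ _ hv).2.2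
  exact ⟨Nat.findGreatest (R a) b, Nat.findGreatest_spec hb hv,
    fun w hw => Nat.le_findGreatest (hR.bounds _ _ hw).2.2 hw⟩

/-- Removing the longest edge at `a` splits a noncrossing tree into three parts. -/
theorem exists_split (hR : IsNCTreeRel R a b) {j : ℕ} (hj : R a j) (hmax : ∀ v, R a v → v ≤ j) :
    ∃ i, a ≤ i ∧ i < j ∧
      ∀ u v, R u v → ¬(u = a ∧ v = j) → v ≤ i ∨ (i < u ∧ v ≤ j) ∨ j ≤ u := by
  classical
  obtain ⟨P, ha, hnj, hP⟩ := hR.acyclic a j hj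
  have haj := hR.bounds a j hj
  set i := Nat.findGreatest (fun x => x < j ∧ P x) j
  have hai : a ≤ i := Nat.le_findGreatest haj.2.1.le ⟨haj.2.1, ha⟩
  have hPi : i < j ∧ P i :=
    Nat.findGreatest_spec (P := fun x => x < j ∧ P x) haj.2.1.le ⟨haj.2.1, ha⟩
  have himax : ∀ x, x < j → P x → x ≤ i := fun x hx hPx => Nat.le_findGreatest hx.le ⟨hx, hPx⟩
  refine ⟨i, hai, hPi.1, fun u v huv hne => ?_⟩
  have hbuv := hR.bounds u v huv
  have hnc := hR.noncrossing a j u v hj huv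
  by_contra! hcon
  have hvj : v ≤ j := by
    rcases hbuv.1.eq_or_lt with rfl | hlt
    · exact hmax v huv
    · omega
  have hui : u ≤ i := by omega
  have hPv : ¬P v := by
    intro h
    rcases hvj.eq_or_lt with rfl | hlt
    · exact hnj h
    · have := himax v hlt h; omega
  have hPu : ¬P u := fun h => hPv ((hP u v huv hne).mp h)
  have key := hR.connected (fun x => P x ∧ u < x ∧ x < v) (fun x y hxy => by
    have h₁ := hR.noncrossing u v x y huv hxy
    have h₂ := hR.noncrossing x y u v hxy huv
    have h₃ := hP x y hxy
    have h₄ := hR.bounds x y hxy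
    grind) i hai (by omega)
  grind

theorem left (hR : IsNCTreeRel R a b) {i j : ℕ} (hj : R a j) (hai : a ≤ i) (hij : i < j)
    (hsplit : ∀ u v, R u v → ¬(u = a ∧ v = j) → v ≤ i ∨ (i < u ∧ v ≤ j) ∨ j ≤ u) :
    IsNCTreeRel (fun u v => R u v ∧ v ≤ i) a i where
  bounds := by have := hR.bounds; grind
  noncrossing := by have := hR.noncrossing; grind
  connected P hP x hx hx' := by
    have hbd := hR.bounds
    have hb := hbd _ _ hj
    have := hR.connected (fun x => if x ≤ i then P x else P a) (by grind) x hx (by omega)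
    grind
  acyclic u v huv := by
    obtain ⟨P, hu, hv, hP⟩ := hR.acyclic u v huv.1
    exact ⟨P, hu, hv, fun x y h => hP x y h.1⟩

theorem middle (hR : IsNCTreeRel R a b) {i j : ℕ} (hj : R a j) (hai : a ≤ i) (hij : i < j)
    (hsplit : ∀ u v, R u v → ¬(u = a ∧ v = j) → v ≤ i ∨ (i < u ∧ v ≤ j) ∨ j ≤ u) :
    IsNCTreeRel (fun u v => R u v ∧ i < u ∧ v ≤ j) (i + 1) j where
  bounds := by have := hR.bounds; grind
  noncrossing := by have := hR.noncrossing; grind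
  connected P hP x hx hx' := by
    have hbd := hR.bounds
    have hb := hbd _ _ hj
    have := hR.connected (fun x => if i < x ∧ x ≤ j then P x else P j) (by grind)
    have h₁ := this x (by omega) (by omega)
    have h₂ := this (i + 1) (by omega) (by omega)
    grind
  acyclic u v huv := by
    obtain ⟨P, hu, hv, hP⟩ := hR.acyclic u v huv.1
    exact ⟨P, hu, hv, fun x y h => hP x y h.1⟩

theorem right (hR : IsNCTreeRel R a b) {i j : ℕ} (hj : R a j) (hai : a ≤ i) (hij : i < j)
    (hsplit : ∀ u v, R u v → ¬(u = a ∧ v = j) → v ≤ i ∨ (i < u ∧ v ≤ j) ∨ j ≤ u) :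
    IsNCTreeRel (fun u v => R u v ∧ j ≤ u) j b where
  bounds := by have := hR.bounds; grind
  noncrossing := by have := hR.noncrossing; grind
  connected P hP x hx hx' := by
    have hbd := hR.bounds
    have hb := hbd _ _ hj
    have := hR.connected (fun x => if j ≤ x then P x else P j) (by grind) x (by omega) hx'
    grind
  acyclic u v huv := by
    obtain ⟨P, hu, hv, hP⟩ := hR.acyclic u v huv.1
    exact ⟨P, hu, hv, fun x y h => hP x y h.1⟩

theorem exists_ternaryTree {n : ℕ} (hR : IsNCTreeRel R a (a + n)) :
    ∃ t : TernaryTree, t.internals = n ∧ ∀ u v, t.Edge a u v ↔ R u v := by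
  induction n using Nat.strong_induction_on generalizing R a with
  | _ n ih =>
    rcases n.eq_zero_or_pos with rfl | hn
    · refine ⟨.leaf, rfl, fun u v => ⟨False.elim, fun h => ?_⟩⟩
      have := hR.bounds u v h
      omega
    obtain ⟨j, hj, hmax⟩ := hR.exists_max_neighbor (by omega)
    obtain ⟨i, hai, hij, hsplit⟩ := hR.exists_split hj hmax
    have hb := hR.bounds a j hj
    have hl := hR.left hj hai hij hsplit
    have hm := hR.middle hj hai hij hsplit
    have hr := hR.right hj hai hij hsplit
    obtain ⟨p, rfl⟩ := Nat.exists_eq_add_of_le hai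
    obtain ⟨q, rfl⟩ := Nat.exists_eq_add_of_le (Nat.succ_le_of_lt hij)
    obtain ⟨r, hr'⟩ := Nat.exists_eq_add_of_le hb.2.2
    rw [hr'] at hr
    obtain ⟨t₁, rfl, h₁⟩ := ih p (by omega) hl
    obtain ⟨t₂, rfl, h₂⟩ := ih q (by omega) hm
    obtain ⟨t₃, rfl, h₃⟩ := ih r (by omega) hr
    refine ⟨.node t₁ t₂ t₃, by simp only [internals]; omega, fun u v => ?_⟩
    simp only [Edge]
    rw [h₁, h₂, h₃]
    grind

end IsNCTreeRel

/-- The graph on `ZMod (n + 1)` whose edges are given by a relation on their values. -/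
def graphOfRel (n : ℕ) (R : ℕ → ℕ → Prop) : SimpleGraph (ZMod (n + 1)) where
  Adj x y := x.val < y.val ∧ R x.val y.val ∨ y.val < x.val ∧ R y.val x.val
  symm := ⟨fun _ _ h => h.symm⟩
  loopless := ⟨fun _ h => by simp at h⟩

/-- The relation saying that `u < v` are the values of adjacent vertices. -/
def SimpleGraph.valRel {n : ℕ} (G : SimpleGraph (ZMod (n + 1))) (u v : ℕ) : Prop :=
  u < v ∧ v ≤ n ∧ G.Adj (u : ZMod (n + 1)) (v : ZMod (n + 1))

theorem ZMod.val_le_of_succ {n : ℕ} (x : ZMod (n + 1)) : x.val ≤ n :=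
  Nat.lt_succ_iff.mp (ZMod.val_lt x)

theorem graphOfRel_valRel {n : ℕ} (G : SimpleGraph (ZMod (n + 1))) :
    graphOfRel n G.valRel = G := by
  ext x y
  have hx := ZMod.val_le_of_succ x
  have hy := ZMod.val_le_of_succ y
  simp only [graphOfRel, SimpleGraph.valRel, ZMod.natCast_zmod_val]
  constructor
  · rintro (h | h)
    · exact h.2.2.2
    · exact h.2.2.2.symm
  · intro h
    rcases lt_trichotomy x.val y.val with hlt | heq | hlt
    · exact .inl ⟨hlt, hlt, hy, h⟩
    · exact absurd (ZMod.val_injective _ heq) h.ne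
    · exact .inr ⟨hlt, hlt, hx, h.symm⟩

theorem valRel_graphOfRel {n : ℕ} {R : ℕ → ℕ → Prop} (hR : ∀ u v, R u v → u < v ∧ v ≤ n)
    (u v : ℕ) : (graphOfRel n R).valRel u v ↔ R u v := by
  simp only [graphOfRel, SimpleGraph.valRel]
  constructor
  · rintro ⟨huv, hv, h⟩
    rw [ZMod.val_natCast_of_lt (by omega), ZMod.val_natCast_of_lt (by omega)] at h
    have := hR v u
    grind
  · intro h
    have := hR u v h
    rw [ZMod.val_natCast_of_lt (by omega), ZMod.val_natCast_of_lt (by omega)]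
    grind

theorem SimpleGraph.Reachable.iff_of_forall_adj {V : Type*} {G : SimpleGraph V} {P : V → Prop}
    (hP : ∀ x y, G.Adj x y → (P x ↔ P y)) {x y : V} (h : G.Reachable x y) : P x ↔ P y := by
  obtain ⟨p⟩ := h
  induction p with
  | nil => rfl
  | cons h _ ih => exact (hP _ _ h).trans ih

theorem isNCTreeRel_valRel {n : ℕ} {G : SimpleGraph (ZMod (n + 1))} (hG : IsNCTree G) :
    IsNCTreeRel G.valRel 0 n where
  bounds u v h := ⟨u.zero_le, h.1, h.2.1⟩
  noncrossing u v w x h h' := by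
    have := hG.2 _ _ _ _ h.2.2 h'.2.2
    have h₁ := h.1
    have h₂ := h.2.1
    have h₃ := h'.1
    have h₄ := h'.2.1
    rwa [ZMod.val_natCast_of_lt (by omega), ZMod.val_natCast_of_lt (by omega),
      ZMod.val_natCast_of_lt (by omega), ZMod.val_natCast_of_lt (by omega)] at this
  connected P hP x _ hx := by
    have := (hG.1.connected.preconnected (0 : ZMod (n + 1)) (x : ZMod (n + 1))).iff_of_forall_adj
      (P := fun z => P z.val) fun y z hyz => by
        rw [← graphOfRel_valRel G] at hyz
        rcases hyz with h | h
        · exact hP _ _ h.2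
        · exact (hP _ _ h.2).symm
    rwa [ZMod.val_zero, ZMod.val_natCast_of_lt (by omega)] at this
  acyclic u v huv := by
    refine ⟨fun x => (G.deleteEdges {s((u : ZMod (n + 1)), (v : ZMod (n + 1)))}).Reachable u x,
      .rfl, SimpleGraph.isAcyclic_iff_forall_adj_isBridge.mp hG.1.isAcyclic huv.2.2,
      fun x y hxy hne => ?_⟩
    have hadj : (G.deleteEdges {s((u : ZMod (n + 1)), (v : ZMod (n + 1)))}).Adj x y := by
      refine SimpleGraph.deleteEdges_adj.mpr ⟨hxy.2.2, fun h => ?_⟩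
      have hinj {k l : ℕ} (hk : k ≤ n) (hl : l ≤ n) (h : (k : ZMod (n + 1)) = l) : k = l := by
        have := congrArg ZMod.val h
        rwa [ZMod.val_natCast_of_lt (by omega), ZMod.val_natCast_of_lt (by omega)] at this
      have h₁ := huv.1
      have h₂ := huv.2.1
      have h₃ := hxy.1
      have h₄ := hxy.2.1
      rcases Sym2.eq_iff.mp h with ⟨hx, hy⟩ | ⟨hx, hy⟩
      · exact hne ⟨hinj (by omega) (by omega) hx, hinj h₄ h₂ hy⟩
      · have := hinj (by omega) h₂ hx
        have := hinj h₄ (by omega) hy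
        omega
    exact ⟨fun h => h.trans hadj.reachable, fun h => h.trans hadj.symm.reachable⟩

theorem isNCTree_graphOfRel {n : ℕ} {R : ℕ → ℕ → Prop} (hR : IsNCTreeRel R 0 n) :
    IsNCTree (graphOfRel n R) := by
  refine ⟨(SimpleGraph.isTree_iff _).mpr ⟨?_, ?_⟩, fun a b c d hab hcd h => ?_⟩
  · have hreach (x : ZMod (n + 1)) : (graphOfRel n R).Reachable 0 x := by
      have := hR.connected (fun k => (graphOfRel n R).Reachable 0 (k : ZMod (n + 1)))
        (fun u v huv => by
          have hadj := ((valRel_graphOfRel (fun u v h => (hR.bounds u v h).2) u v).mpr huv).2.2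
          exact ⟨fun h => h.trans hadj.reachable, fun h => h.trans hadj.symm.reachable⟩)
        x.val (Nat.zero_le _) (ZMod.val_le_of_succ x)
      rw [ZMod.natCast_zmod_val, Nat.cast_zero] at this
      exact this.mp .rfl
    exact ⟨fun x y => (hreach x).symm.trans (hreach y)⟩
  · have hbridge {x y : ZMod (n + 1)} (h : R x.val y.val) :
        (graphOfRel n R).IsBridge s(x, y) := by
      obtain ⟨P, hx, hy, hP⟩ := hR.acyclic _ _ h
      refine SimpleGraph.isBridge_iff.mpr fun hreach => hy ((hreach.iff_of_forall_adj
        (P := fun z => P z.val) fun z w hzw => ?_).mp hx)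
      obtain ⟨hzw, hne⟩ := SimpleGraph.deleteEdges_adj.mp hzw
      rcases hzw with hzw | hzw
      · exact hP _ _ hzw.2 fun ⟨h₁, h₂⟩ => hne (Sym2.eq_iff.mpr
          (.inl ⟨ZMod.val_injective _ h₁, ZMod.val_injective _ h₂⟩))
      · exact (hP _ _ hzw.2 fun ⟨h₁, h₂⟩ => hne (Sym2.eq_iff.mpr
          (.inr ⟨ZMod.val_injective _ h₂, ZMod.val_injective _ h₁⟩))).symm
    refine SimpleGraph.isAcyclic_iff_forall_adj_isBridge.mpr fun x y hxy => ?_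
    rcases hxy with h | h
    · exact hbridge h.2
    · rw [Sym2.eq_swap]
      exact hbridge h.2
  · rcases hab with hab | hab
    · rcases hcd with hcd | hcd
      · exact hR.noncrossing _ _ _ _ hab.2 hcd.2 h
      · omega
    · omega

theorem T_eq_A (n : ℕ) : T n = A (n + 1) := by
  have hE (t : {t : TernaryTree // t.internals = n}) : IsNCTreeRel (t.1.Edge 0) 0 n := by
    have := isNCTreeRel_edge t.1 0
    rwa [t.2, zero_add] at this
  refine Nat.card_congr (.ofBijective (fun t => ⟨graphOfRel n (t.1.Edge 0),
    isNCTree_graphOfRel (hE t)⟩) ⟨fun t t' h => ?_, fun G => ?_⟩)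
  · refine Subtype.ext (eq_of_edge_iff (s := 0) (t.2.trans t'.2.symm) fun u v => ?_)
    rw [← valRel_graphOfRel (fun u v h => ((hE t).bounds u v h).2),
      ← valRel_graphOfRel (fun u v h => ((hE t').bounds u v h).2),
      show graphOfRel n (t.1.Edge 0) = graphOfRel n (t'.1.Edge 0) from Subtype.ext_iff.mp h]
  · have hG : IsNCTreeRel G.1.valRel 0 (0 + n) := by simpa using isNCTreeRel_valRel G.2
    obtain ⟨t, ht, h⟩ := hG.exists_ternaryTree
    refine ⟨⟨t, ht⟩, Subtype.ext ?_⟩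
    have hEq : t.Edge 0 = G.1.valRel := funext₂ fun u v => propext (h u v)
    exact (congrArg (graphOfRel n) hEq).trans (graphOfRel_valRel G.1)

theorem ternaryTree_count :
    ∀ n : ℕ, (2 * n + 1) * T n = Nat.choose (3 * n) n ∧ T n = A (n + 1) :=
  fun n => ⟨two_mul_add_one_mul_T n, T_eq_A n⟩
end

section
/- For all integers n ≥ 2 and 2 ≤ j ≤ n, the number of n-noncrossing trees that contain the edge {1, j} and contain no edge {1, ℓ} with 2 ≤ ℓ ≤ j−1 equals A(j−1)·A_1(n+2−j). -/
namespace NCTree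

open SimpleGraph

variable {V W : Type*}

theorem reachable_lift {G : SimpleGraph V} {H : SimpleGraph W} (φ : V → W)
    (h : ∀ x y, G.Adj x y → H.Reachable (φ x) (φ y)) {x y : V} (hxy : G.Reachable x y) :
    H.Reachable (φ x) (φ y) := by
  obtain ⟨w⟩ := hxy
  induction w with
  | nil => exact Reachable.refl _
  | cons hadj _ ih => exact (h _ _ hadj).trans ih

theorem exists_adj_of_reachable {G : SimpleGraph V} (P : V → Prop) {x y : V}
    (hxy : G.Reachable x y) (hx : P x) (hy : ¬ P y) : ∃ a b, G.Adj a b ∧ P a ∧ ¬ P b := by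
  obtain ⟨w⟩ := hxy
  induction w with
  | nil => exact absurd hx hy
  | @cons u v _ hadj _ ih =>
    by_cases hv : P v
    · exact ih hv hy
    · exact ⟨u, v, hadj, hx, hv⟩

/-- `G` has all its edges inside `S` and is a tree on the vertex set `S`. -/
structure IsTreeOn (S : Set V) (G : SimpleGraph V) : Prop where
  supp : ∀ x y, G.Adj x y → x ∈ S
  nonempty : S.Nonempty
  conn : ∀ x ∈ S, ∀ y ∈ S, G.Reachable x y
  bridge : ∀ x y, G.Adj x y → ¬ (G.deleteEdges {s(x, y)}).Reachable x y

theorem IsTreeOn.supp_right {S : Set V} {G : SimpleGraph V} (h : IsTreeOn S G) (x y : V)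
    (hxy : G.Adj x y) : y ∈ S := h.supp y x hxy.symm

theorem isTreeOn_univ_iff {G : SimpleGraph V} : IsTreeOn Set.univ G ↔ G.IsTree := by
  constructor
  · intro h
    have : Nonempty V := ⟨h.nonempty.some⟩
    refine ⟨⟨fun x y => h.conn x trivial y trivial⟩, ?_⟩
    rw [isAcyclic_iff_forall_adj_isBridge]
    intro x y hxy
    rw [isBridge_iff]
    exact h.bridge x y hxy
  · intro h
    refine ⟨fun _ _ _ => trivial, ?_, fun x _ y _ => h.1.preconnected x y, ?_⟩
    · have := h.1.nonempty
      exact Set.univ_nonempty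
    · intro x y hxy
      have := isAcyclic_iff_forall_adj_isBridge.1 h.2 hxy
      rw [isBridge_iff] at this
      exact this

/-- The edges of `G` with both ends in `S`. -/
def restr (S : Set V) (G : SimpleGraph V) : SimpleGraph V where
  Adj x y := G.Adj x y ∧ x ∈ S ∧ y ∈ S
  symm := ⟨fun _ _ h => ⟨h.1.symm, h.2.2, h.2.1⟩⟩
  loopless := ⟨fun _ h => h.1.ne rfl⟩

theorem restr_adj {S : Set V} {G : SimpleGraph V} {x y : V} :
    (restr S G).Adj x y ↔ G.Adj x y ∧ x ∈ S ∧ y ∈ S := Iff.rfl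

theorem IsTreeOn.restr {S T : Set V} {G : SimpleGraph V} (h : IsTreeOn T G) (hST : S ⊆ T)
    {r : V} (hr : r ∈ S) (hb : ∀ x y, G.Adj x y → x ∈ S → y ∉ S → x = r) :
    IsTreeOn S (restr S G) := by
  classical
  refine ⟨fun x y hxy => hxy.2.1, ⟨r, hr⟩, ?_, ?_⟩
  · intro x hx y hy
    have := reachable_lift (H := NCTree.restr S G) (fun z => if z ∈ S then z else r) ?_
      (h.conn x (hST hx) y (hST hy))
    · simpa [hx, hy] using this
    · intro u v huv
      by_cases hu : u ∈ S <;> by_cases hv : v ∈ S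
      · simp only [hu, hv, if_true]
        exact Adj.reachable ⟨huv, hu, hv⟩
      · simp [hv, hb u v huv hu hv]
      · simp [hu, hb v u huv.symm hv hu]
      · simp [hu, hv]
  · intro x y hxy hr
    refine h.bridge x y hxy.1 (hr.mono ?_)
    intro u v huv
    rw [deleteEdges_adj] at huv ⊢
    exact ⟨huv.1.1, huv.2⟩

theorem IsTreeOn.bridge_sup {S T : Set V} {v : V} {G H : SimpleGraph V}
    (hG : IsTreeOn S G) (hH : IsTreeOn T H) (hST : ∀ x ∈ S, x ∈ T → x = v)
    {x y : V} (hxy : G.Adj x y) : ¬ ((G ⊔ H).deleteEdges {s(x, y)}).Reachable x y := by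
  classical
  intro hr
  have hx := hG.supp _ _ hxy
  have hy := hG.supp_right _ _ hxy
  refine hG.bridge x y hxy ?_
  have := reachable_lift (H := G.deleteEdges {s(x, y)}) (fun z => if z ∈ S then z else v) ?_ hr
  · simpa [hx, hy] using this
  · intro a b hab
    rw [deleteEdges_adj, sup_adj] at hab
    obtain ⟨hab | hab, hne⟩ := hab
    · simp only [hG.supp _ _ hab, hG.supp_right _ _ hab, if_true]
      exact Adj.reachable ((deleteEdges_adj).2 ⟨hab, hne⟩)
    · have key : ∀ z ∈ T, (if z ∈ S then z else v) = v := by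
        intro z hz
        split_ifs with hs
        · exact hST z hs hz
        · rfl
      simp only [key a (hH.supp _ _ hab), key b (hH.supp_right _ _ hab)]
      exact Reachable.refl _

theorem IsTreeOn.sup {S T : Set V} {v : V} {G H : SimpleGraph V}
    (hG : IsTreeOn S G) (hH : IsTreeOn T H) (hvS : v ∈ S) (hvT : v ∈ T)
    (hST : ∀ x ∈ S, x ∈ T → x = v) : IsTreeOn (S ∪ T) (G ⊔ H) := by
  have hroot : ∀ x ∈ S ∪ T, (G ⊔ H).Reachable x v := by
    rintro x (hx | hx)
    · exact (hG.conn x hx v hvS).mono le_sup_left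
    · exact (hH.conn x hx v hvT).mono le_sup_right
  refine ⟨?_, ⟨v, Or.inl hvS⟩, fun x hx y hy => (hroot x hx).trans (hroot y hy).symm, ?_⟩
  · rintro x y (h | h)
    · exact Or.inl (hG.supp _ _ h)
    · exact Or.inr (hH.supp _ _ h)
  · rintro x y (h | h)
    · exact hG.bridge_sup hH hST h
    · rw [sup_comm]
      exact hH.bridge_sup hG (fun z hz hz' => hST z hz' hz) h

theorem isTreeOn_edge {s t : V} (hst : s ≠ t) : IsTreeOn {s, t} (edge s t) := by
  have hadj : (edge s t).Adj s t := by simp [edge_adj, hst]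
  refine ⟨?_, ⟨s, Or.inl rfl⟩, ?_, ?_⟩
  · intro x y hxy
    rw [edge_adj] at hxy
    simp only [Set.mem_insert_iff, Set.mem_singleton_iff]
    tauto
  · rintro x (rfl | rfl) y (rfl | rfl)
    exacts [Reachable.refl _, hadj.reachable, hadj.symm.reachable, Reachable.refl _]
  · intro x y hxy hr
    obtain ⟨a, b, hab, rfl, hb⟩ := exists_adj_of_reachable (fun z => z = x) hr rfl hxy.ne'
    rw [deleteEdges_adj, edge_adj] at hab
    rw [edge_adj] at hxy
    simp only [Set.mem_singleton_iff] at hab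
    grind

/-- A tree on `S` with no two crossing edges, where `l` gives the position of the vertices. -/
structure IsNCTreeOn (l : V → ℕ) (S : Set V) (G : SimpleGraph V) : Prop extends
    IsTreeOn S G where
  nc : ∀ a b c d, G.Adj a b → G.Adj c d → ¬ (l a < l c ∧ l c < l b ∧ l b < l d)

/-- The pullback of `G` along `f`, restricted to `S`. -/
def pull (f : V → W) (S : Set V) (G : SimpleGraph W) : SimpleGraph V where
  Adj x y := x ∈ S ∧ y ∈ S ∧ G.Adj (f x) (f y)
  symm := ⟨fun _ _ h => ⟨h.2.1, h.1, h.2.2.symm⟩⟩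
  loopless := ⟨fun _ h => h.2.2.ne rfl⟩

theorem IsNCTreeOn.pull {l : V → ℕ} {l' : W → ℕ} {S : Set V} {T : Set W} {f : V → W} {g : W → V}
    (hf : ∀ x ∈ S, f x ∈ T ∧ g (f x) = x) (hg : ∀ x ∈ T, g x ∈ S ∧ f (g x) = x)
    (hl : ∀ x ∈ S, ∀ y ∈ S, l x < l y → l' (f x) < l' (f y))
    {G : SimpleGraph W} (h : IsNCTreeOn l' T G) : IsNCTreeOn l S (pull f S G) := by
  refine ⟨⟨fun x y hxy => hxy.1, ?_, ?_, ?_⟩, ?_⟩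
  · obtain ⟨x, hx⟩ := h.nonempty
    exact ⟨g x, (hg x hx).1⟩
  · intro x hx y hy
    have := reachable_lift (H := NCTree.pull f S G) g ?_
      (h.conn _ (hf x hx).1 _ (hf y hy).1)
    · rwa [(hf x hx).2, (hf y hy).2] at this
    · intro u v huv
      have hu := hg u (h.supp _ _ huv)
      have hv := hg v (h.supp_right _ _ huv)
      refine Adj.reachable ⟨hu.1, hv.1, ?_⟩
      rwa [hu.2, hv.2]
  · intro x y hxy hr
    refine h.bridge _ _ hxy.2.2 (reachable_lift f ?_ hr)
    intro u v huv
    rw [deleteEdges_adj] at huv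
    refine Adj.reachable ((deleteEdges_adj).2 ⟨huv.1.2.2, ?_⟩)
    have h1 := (hf u huv.1.1).2
    have h2 := (hf v huv.1.2.1).2
    have h3 := (hf x hxy.1).2
    have h4 := (hf y hxy.2.1).2
    have h5 := huv.2
    simp only [Set.mem_singleton_iff, Sym2.eq_iff] at h5 ⊢
    grind
  · intro a b c d hab hcd hlt
    exact h.nc _ _ _ _ hab.2.2 hcd.2.2 ⟨hl _ hab.1 _ hcd.1 hlt.1, hl _ hcd.1 _ hab.2.1 hlt.2.1,
      hl _ hab.2.1 _ hcd.2.1 hlt.2.2⟩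

theorem IsTreeOn.pull_pull {S : Set V} {T : Set W} {f : V → W} {g : W → V}
    (hf : ∀ x ∈ S, f x ∈ T ∧ g (f x) = x) {G : SimpleGraph V} (h : IsTreeOn S G) :
    pull f S (pull g T G) = G := by
  ext x y
  constructor
  · rintro ⟨hx, hy, -, -, hxy⟩
    rwa [(hf x hx).2, (hf y hy).2] at hxy
  · intro hxy
    have hx := h.supp _ _ hxy
    have hy := h.supp_right _ _ hxy
    refine ⟨hx, hy, (hf x hx).1, (hf y hy).1, ?_⟩
    rwa [(hf x hx).2, (hf y hy).2]

/-- Noncrossing trees on order isomorphic vertex sets are in bijection. -/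
def pullEquiv {l : V → ℕ} {l' : W → ℕ} {S : Set V} {T : Set W} {f : V → W} {g : W → V}
    (hf : ∀ x ∈ S, f x ∈ T ∧ g (f x) = x) (hg : ∀ x ∈ T, g x ∈ S ∧ f (g x) = x)
    (hl : ∀ x ∈ S, ∀ y ∈ S, l x < l y → l' (f x) < l' (f y))
    (hl' : ∀ x ∈ T, ∀ y ∈ T, l' x < l' y → l (g x) < l (g y))
    (Q : SimpleGraph V → Prop) :
    {G : SimpleGraph V // IsNCTreeOn l S G ∧ Q G} ≃
      {G : SimpleGraph W // IsNCTreeOn l' T G ∧ Q (pull f S G)} where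
  toFun G := ⟨pull g T G.1, G.2.1.pull hg hf hl', by
    rw [G.2.1.toIsTreeOn.pull_pull hf]; exact G.2.2⟩
  invFun G := ⟨pull f S G.1, G.2.1.pull hf hg hl, G.2.2⟩
  left_inv G := Subtype.ext (G.2.1.toIsTreeOn.pull_pull hf)
  right_inv G := Subtype.ext (G.2.1.toIsTreeOn.pull_pull hg)

/-- The noncrossing trees on the set `S` of natural numbers. -/
abbrev TreesOn (S : Set ℕ) : Type := {G : SimpleGraph ℕ // IsNCTreeOn id S G}

/-- `TreesOn S` only depends on the order type of `S`. -/
def treesOnCongr {S T : Set ℕ} (f g : ℕ → ℕ)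
    (hf : ∀ x ∈ S, f x ∈ T ∧ g (f x) = x) (hg : ∀ x ∈ T, g x ∈ S ∧ f (g x) = x)
    (hl : ∀ x ∈ S, ∀ y ∈ S, x < y → f x < f y)
    (hl' : ∀ x ∈ T, ∀ y ∈ T, x < y → g x < g y) : TreesOn S ≃ TreesOn T :=
  (Equiv.subtypeEquivRight fun _ => (and_iff_left trivial).symm).trans <|
    (pullEquiv (l := id) (l' := id) hf hg hl hl' fun _ => True).trans <|
      Equiv.subtypeEquivRight fun _ => and_iff_left trivial

/-- Noncrossing trees on `ZMod n`, viewed as graphs on the natural numbers below `n`. -/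
def zmodEquiv (n : ℕ) [NeZero n] (Q : SimpleGraph (ZMod n) → Prop) :
    {G : SimpleGraph (ZMod n) // IsNCTree G ∧ Q G} ≃
      {G : SimpleGraph ℕ // IsNCTreeOn id (Set.Iio n) G ∧ Q (pull ZMod.val Set.univ G)} :=
  (Equiv.subtypeEquivRight fun G => by
    refine and_congr_left fun _ => ?_
    constructor
    · intro h
      exact ⟨isTreeOn_univ_iff.2 h.1, h.2⟩
    · intro h
      exact ⟨isTreeOn_univ_iff.1 h.1, h.2⟩).trans <|
  pullEquiv (l := ZMod.val) (S := Set.univ) (g := fun x : ℕ => (x : ZMod n))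
    (fun x _ => ⟨ZMod.val_lt x, ZMod.natCast_zmod_val x⟩)
    (fun x hx => ⟨trivial, ZMod.val_cast_of_lt hx⟩)
    (fun x _ y _ h => h)
    (fun x hx y hy h => by
      rw [ZMod.val_cast_of_lt hx, ZMod.val_cast_of_lt hy]; exact h) Q

theorem A_eq (n : ℕ) [NeZero n] : A n = Nat.card (TreesOn (Set.Iio n)) := by
  refine Nat.card_congr ?_
  exact (Equiv.subtypeEquivRight fun _ => (and_iff_left trivial).symm).trans <|
    (zmodEquiv n fun _ => True).trans <| Equiv.subtypeEquivRight fun _ => and_iff_left trivial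

/-- The noncrossing trees on `{0, …, n - 1}` obtained from noncrossing trees on `{1, …, k}`,
`{k, …, c}` and `{0, c + 1, …, n - 1}` by adding the edge `{0, k}`. -/
structure IsSplit (n k c : ℕ) (G : SimpleGraph ℕ) : Prop where
  tree : IsNCTreeOn id (Set.Iio n) G
  adj : G.Adj 0 k
  cases : ∀ x y, G.Adj x y → x < y → (x = 0 ∧ y = k) ∨ (1 ≤ x ∧ y ≤ k) ∨ (k ≤ x ∧ y ≤ c) ∨
    ((x = 0 ∨ c < x) ∧ c < y)

theorem IsNCTreeOn.restr {S T : Set ℕ} {G : SimpleGraph ℕ} (h : IsNCTreeOn id T G) (hST : S ⊆ T)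
    {r : ℕ} (hr : r ∈ S) (hb : ∀ x y, G.Adj x y → x ∈ S → y ∉ S → x = r) :
    IsNCTreeOn id S (restr S G) :=
  ⟨h.toIsTreeOn.restr hST hr hb, fun a b c d hab hcd => h.nc a b c d hab.1 hcd.1⟩

/-- The vertex set `{0, c + 1, …, n - 1}`. -/
abbrev outer (n c : ℕ) : Set ℕ := {x | x = 0 ∨ (c < x ∧ x < n)}

theorem IsSplit.cases' {n k c : ℕ} {G : SimpleGraph ℕ} (h : IsSplit n k c G) (x y : ℕ)
    (hxy : G.Adj x y) : (x = 0 ∧ y = k) ∨ (y = 0 ∧ x = k) ∨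
      (x ∈ Set.Icc 1 k ∧ y ∈ Set.Icc 1 k) ∨ (x ∈ Set.Icc k c ∧ y ∈ Set.Icc k c) ∨
      (x ∈ outer n c ∧ y ∈ outer n c) := by
  have hx : x < n := h.tree.supp _ _ hxy
  have hy : y < n := h.tree.supp_right _ _ hxy
  simp only [Set.mem_Icc, Set.mem_ofPred_eq]
  rcases lt_trichotomy x y with hlt | rfl | hlt
  · have := h.cases x y hxy hlt
    omega
  · exact absurd rfl hxy.ne
  · have := h.cases y x hxy.symm hlt
    omega

theorem isSplit_sup {n k c : ℕ} (hk : 1 ≤ k) (hkc : k ≤ c) (hcn : c < n) {G₁ G₂ G₃ : SimpleGraph ℕ}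
    (h₁ : IsNCTreeOn id (Set.Icc 1 k) G₁) (h₂ : IsNCTreeOn id (Set.Icc k c) G₂)
    (h₃ : IsNCTreeOn id (outer n c) G₃) : IsSplit n k c (G₁ ⊔ G₂ ⊔ edge 0 k ⊔ G₃) := by
  have ht := ((h₁.toIsTreeOn.sup (v := k) h₂.toIsTreeOn (by simp [hk]) (by simp [hkc])
    (by simp only [Set.mem_Icc]; omega)).sup (v := k) (isTreeOn_edge (s := 0) (t := k) (by omega))
    (by simp [hk]) (by simp) (by
      simp only [Set.mem_union, Set.mem_Icc, Set.mem_insert_iff, Set.mem_singleton_iff]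
      omega)).sup (v := 0) h₃.toIsTreeOn (by simp) (by simp) (by
      simp only [Set.mem_union, Set.mem_Icc, Set.mem_insert_iff, Set.mem_singleton_iff,
        Set.mem_ofPred_eq]
      omega)
  have hS : Set.Icc 1 k ∪ Set.Icc k c ∪ {0, k} ∪ outer n c = Set.Iio n := by
    ext x
    simp only [Set.mem_union, Set.mem_Icc, Set.mem_insert_iff, Set.mem_singleton_iff,
        Set.mem_ofPred_eq, Set.mem_Iio]
    omega
  rw [hS] at ht
  have hc : ∀ x y, (G₁ ⊔ G₂ ⊔ edge 0 k ⊔ G₃).Adj x y →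
      (G₁.Adj x y ∧ 1 ≤ x ∧ x ≤ k ∧ 1 ≤ y ∧ y ≤ k) ∨
      (G₂.Adj x y ∧ k ≤ x ∧ x ≤ c ∧ k ≤ y ∧ y ≤ c) ∨
      (x = 0 ∧ y = k) ∨ (x = k ∧ y = 0) ∨
      (G₃.Adj x y ∧ (x = 0 ∨ c < x) ∧ (y = 0 ∨ c < y)) := by
    rintro x y (((h | h) | h) | h)
    · have := h₁.supp _ _ h
      have := h₁.supp_right _ _ h
      simp_all
    · have := h₂.supp _ _ h
      have := h₂.supp_right _ _ h
      simp_all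
    · rw [edge_adj] at h
      omega
    · have := h₃.supp _ _ h
      have := h₃.supp_right _ _ h
      simp only [Set.mem_ofPred_eq] at *
      refine Or.inr (Or.inr (Or.inr (Or.inr ⟨h, ?_, ?_⟩))) <;> omega
  refine ⟨⟨ht, ?_⟩, ?_, ?_⟩
  · intro a b p q hab hpq hlt
    have hne := hpq.ne
    have hne' := hab.ne
    simp only [id] at hlt
    rcases hc _ _ hab with h | h | h | h | h <;> rcases hc _ _ hpq with h' | h' | h' | h' | h'
    case inl.inl => exact h₁.nc _ _ _ _ h.1 h'.1 hlt
    case inr.inl.inr.inl => exact h₂.nc _ _ _ _ h.1 h'.1 hlt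
    case inr.inr.inr.inr.inr.inr.inr.inr => exact h₃.nc _ _ _ _ h.1 h'.1 hlt
    all_goals omega
  · exact Or.inl (Or.inr ((edge_adj _ _ _ _).2 ⟨Or.inl ⟨rfl, rfl⟩, by omega⟩))
  · intro x y hxy hlt
    rcases hc _ _ hxy with h | h | h | h | h <;> omega

/-- A split tree amounts to a choice of its three pieces. -/
def splitEquiv {n k c : ℕ} (hk : 1 ≤ k) (hkc : k ≤ c) (hcn : c < n) :
    {G : SimpleGraph ℕ // IsSplit n k c G} ≃
      TreesOn (Set.Icc 1 k) × TreesOn (Set.Icc k c) × TreesOn (outer n c) where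
  toFun G :=
    (⟨restr (Set.Icc 1 k) G.1, G.2.tree.restr (r := k)
      (by intro x; simp only [Set.mem_Icc, Set.mem_Iio]; omega) (by simp [hk])
      (by
        intro x y hxy
        have := G.2.cases' x y hxy
        simp only [Set.mem_Icc, Set.mem_ofPred_eq] at *
        omega)⟩,
    ⟨restr (Set.Icc k c) G.1, G.2.tree.restr (r := k)
      (by intro x; simp only [Set.mem_Icc, Set.mem_Iio]; omega) (by simp [hkc])
      (by
        intro x y hxy
        have := G.2.cases' x y hxy
        simp only [Set.mem_Icc, Set.mem_ofPred_eq] at *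
        omega)⟩,
    ⟨restr (outer n c) G.1, G.2.tree.restr (r := 0)
      (by intro x; simp only [Set.mem_ofPred_eq, Set.mem_Iio]; omega) (by simp)
      (by
        intro x y hxy
        have := G.2.cases' x y hxy
        simp only [Set.mem_Icc, Set.mem_ofPred_eq] at *
        omega)⟩)
  invFun P := ⟨P.1.1 ⊔ P.2.1.1 ⊔ edge 0 k ⊔ P.2.2.1,
    isSplit_sup hk hkc hcn P.1.2 P.2.1.2 P.2.2.2⟩
  left_inv G := by
    apply Subtype.ext
    ext x y
    have h := G.2.cases' x y
    have h0 := G.2.adj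
    simp only [sup_adj, restr_adj, edge_adj]
    constructor
    · rintro (((h | h) | ⟨⟨rfl, rfl⟩ | ⟨rfl, rfl⟩, -⟩) | h)
      exacts [h.1, h.1, h0, h0.symm, h.1]
    · intro hxy
      have := hxy.ne
      have := h hxy
      tauto
  right_inv P := by
    obtain ⟨⟨G₁, h₁⟩, ⟨G₂, h₂⟩, ⟨G₃, h₃⟩⟩ := P
    have e₁ : ∀ x y, G₁.Adj x y → 1 ≤ x ∧ x ≤ k ∧ 1 ≤ y ∧ y ≤ k := fun x y h =>
      ⟨(h₁.supp _ _ h).1, (h₁.supp _ _ h).2, (h₁.supp_right _ _ h).1, (h₁.supp_right _ _ h).2⟩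
    have e₂ : ∀ x y, G₂.Adj x y → k ≤ x ∧ x ≤ c ∧ k ≤ y ∧ y ≤ c := fun x y h =>
      ⟨(h₂.supp _ _ h).1, (h₂.supp _ _ h).2, (h₂.supp_right _ _ h).1, (h₂.supp_right _ _ h).2⟩
    have e₃ : ∀ x y, G₃.Adj x y → (x = 0 ∨ (c < x ∧ x < n)) ∧ (y = 0 ∨ (c < y ∧ y < n)) :=
      fun x y h => ⟨h₃.supp _ _ h, h₃.supp_right _ _ h⟩
    refine Prod.ext (Subtype.ext ?_) (Prod.ext (Subtype.ext ?_) (Subtype.ext ?_)) <;> ext x y <;>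
      simp only [sup_adj, restr_adj, edge_adj, Set.mem_Icc, Set.mem_ofPred_eq] <;>
      have a₁ := e₁ x y <;> have a₂ := e₂ x y <;> have a₃ := e₃ x y
    · have := G₁.ne_of_adj (a := x) (b := y)
      have := G₂.ne_of_adj (a := x) (b := y)
      grind
    · have := G₁.ne_of_adj (a := x) (b := y)
      have := G₂.ne_of_adj (a := x) (b := y)
      grind
    · have := G₃.ne_of_adj (a := x) (b := y)
      grind

/-- The pieces of a split tree, up to relabelling. -/
def splitEquivIio {n k c q r : ℕ} (hk : 1 ≤ k) (hq : 1 ≤ q) (hr : 1 ≤ r) (hc : c + 1 = k + q)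
    (hn : n = c + r) : {G : SimpleGraph ℕ // IsSplit n k c G} ≃
      TreesOn (Set.Iio k) × TreesOn (Set.Iio q) × TreesOn (Set.Iio r) :=
  (splitEquiv hk (by omega) (by omega)).trans <| Equiv.prodCongr
    (treesOnCongr (· - 1) (· + 1) (by simp only [Set.mem_Icc, Set.mem_Iio]; omega)
      (by simp only [Set.mem_Icc, Set.mem_Iio]; omega)
      (by simp only [Set.mem_Icc]; omega) (by simp only [Set.mem_Iio]; omega)) <| Equiv.prodCongr
    (treesOnCongr (· - k) (· + k) (by simp only [Set.mem_Icc, Set.mem_Iio]; omega)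
      (by simp only [Set.mem_Icc, Set.mem_Iio]; omega)
      (by simp only [Set.mem_Icc]; omega) (by simp only [Set.mem_Iio]; omega))
    (treesOnCongr (· - c) (fun x => if x = 0 then 0 else x + c)
      (by simp only [Set.mem_ofPred_eq, Set.mem_Iio]; intro x hx; split_ifs <;> omega)
      (by simp only [Set.mem_ofPred_eq, Set.mem_Iio]; intro x hx; split_ifs <;> omega)
      (by simp only [Set.mem_ofPred_eq]; omega)
      (by simp only [Set.mem_Iio]; intro x hx y hy hxy; split_ifs <;> omega))

theorem IsSplit.le_of_isSplit {n k c c' : ℕ} {G : SimpleGraph ℕ} (hk : 1 ≤ k) (hkc : k ≤ c)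
    (hcn' : c' < n) (h : IsSplit n k c G) (h' : IsSplit n k c' G) : c' ≤ c := by
  by_contra! hlt
  have ht := ((splitEquiv hk hkc (by omega)) ⟨G, h⟩).2.2.2
  have hr := ht.conn (c + 1) (by simp only [Set.mem_ofPred_eq]; omega) 0 (by simp)
  obtain ⟨a, b, hab, ha, hb⟩ := exists_adj_of_reachable (fun z => 1 ≤ z ∧ z ≤ c') hr
    (by omega) (by omega)
  obtain ⟨hab, ha', hb'⟩ := hab
  have := h'.cases' a b hab
  simp only [Set.mem_Icc, Set.mem_ofPred_eq] at *
  omega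

theorem exists_isSplit {n k : ℕ} {G : SimpleGraph ℕ} (hk : 1 ≤ k) (hG : IsNCTreeOn id (Set.Iio n) G)
    (h0 : G.Adj 0 k) (hlow : ∀ i, 1 ≤ i → i < k → ¬ G.Adj 0 i) :
    ∃ c, k ≤ c ∧ c < n ∧ IsSplit n k c G := by
  classical
  have hkn : k < n := hG.supp_right _ _ h0
  set D := G.deleteEdges {s(0, k)} with hD
  have hDadj : ∀ x y, D.Adj x y ↔ G.Adj x y ∧ ¬ ((x = 0 ∧ y = k) ∨ (x = k ∧ y = 0)) := by
    intro x y
    simp [hD, deleteEdges_adj]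
  have hb : ¬ D.Reachable 0 k := hG.bridge _ _ h0
  have hor : ∀ x < n, D.Reachable x 0 ∨ D.Reachable x k := by
    intro x hx
    by_contra hcon
    obtain ⟨a, b, hab, ha, hb⟩ := exists_adj_of_reachable
      (fun z => ¬ (D.Reachable z 0 ∨ D.Reachable z k))
      (hG.conn x hx 0 (by simp only [Set.mem_Iio]; omega)) hcon (by simp)
    simp only [not_not] at hb
    by_cases he : D.Adj a b
    · exact ha (hb.imp he.reachable.trans he.reachable.trans)
    · have : (a = 0 ∧ b = k) ∨ (a = k ∧ b = 0) := by
        by_contra hh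
        exact he ((hDadj a b).2 ⟨hab, hh⟩)
      rcases this with ⟨rfl, -⟩ | ⟨rfl, -⟩ <;> exact ha (by simp)
  have hnc : ∀ a b p q, G.Adj a b → G.Adj p q → a < p → p < b → b < q → False :=
    fun a b p q h1 h2 h3 h4 h5 => hG.nc a b p q h1 h2 ⟨h3, h4, h5⟩
  have hbelow : ∀ x, 1 ≤ x → x ≤ k → D.Reachable x k := by
    intro x hx1 hxk
    by_contra hcon
    have hx0 := (hor x (by omega)).resolve_right hcon
    obtain ⟨a, b, hab, ⟨ha1, ha2, ha3⟩, hb⟩ := exists_adj_of_reachable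
      (fun z => 1 ≤ z ∧ z ≤ k ∧ ¬ D.Reachable z k) hx0 ⟨hx1, hxk, hcon⟩ (by omega)
    have hak : a ≠ k := by rintro rfl; exact ha3 (Reachable.refl _)
    have hb3 : ¬ D.Reachable b k := fun h => ha3 (hab.reachable.trans h)
    have hab' := ((hDadj a b).1 hab).1
    have : b = 0 ∨ k < b := by
      by_contra hh
      exact hb ⟨by omega, by omega, hb3⟩
    rcases this with rfl | hlt
    · exact hlow a ha1 (by omega) hab'.symm
    · exact hnc 0 k a b h0 hab' (by omega) (by omega) hlt
  have habove : ∀ y z, D.Reachable y k → k < z → z < y → y < n → D.Reachable z k := by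
    intro y z hy hkz hzy hyn
    by_contra hcon
    obtain ⟨p, q, hpq, ⟨hp, hpk⟩, hq⟩ := exists_adj_of_reachable
      (fun w => z < w ∧ D.Reachable w k) hy ⟨hzy, hy⟩ (by omega)
    have hqk : D.Reachable q k := hpq.symm.reachable.trans hpk
    have hqz : q < z := by
      have : q ≠ z := by rintro rfl; exact hcon hqk
      have : ¬ z < q := fun h => hq ⟨h, hqk⟩
      omega
    have hq0 : q ≠ 0 := by rintro rfl; exact hb hqk
    have hz0 := (hor z (by omega)).resolve_right hcon
    obtain ⟨a, b, hab, ⟨ha1, ha2, ha3⟩, hb'⟩ := exists_adj_of_reachable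
      (fun w => q < w ∧ w < p ∧ ¬ D.Reachable w k) hz0 ⟨hqz, hp, hcon⟩ (by omega)
    have hb3 : ¬ D.Reachable b k := fun h => ha3 (hab.reachable.trans h)
    have hbq : b ≠ q := by rintro rfl; exact hb3 hqk
    have hbp : b ≠ p := by rintro rfl; exact hb3 hpk
    have hab' := ((hDadj a b).1 hab).1
    have hpq' := ((hDadj p q).1 hpq).1
    have : b < q ∨ p < b := by
      by_contra hh
      exact hb' ⟨by omega, by omega, hb3⟩
    rcases this with hlt | hlt
    · exact hnc b a q p hab'.symm hpq'.symm hlt ha1 ha2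
    · exact hnc q p a b hpq'.symm hab' ha1 ha2 hlt
  obtain ⟨c, hc⟩ : ∃ c, ∀ x < n, D.Reachable x k ↔ 1 ≤ x ∧ x ≤ c := by
    refine ⟨Nat.findGreatest (fun x => D.Reachable x k) (n - 1), fun x hx => ⟨fun h => ⟨?_, ?_⟩, ?_⟩⟩
    · rcases Nat.eq_zero_or_pos x with rfl | h'
      · exact absurd h hb
      · exact h'
    · exact Nat.le_findGreatest (by omega) h
    · rintro ⟨h1, h2⟩
      have hg : D.Reachable (Nat.findGreatest (fun x => D.Reachable x k) (n - 1)) k :=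
        Nat.findGreatest_spec (P := fun x => D.Reachable x k) (m := k) (by omega)
          (Reachable.refl _)
      have hle := Nat.findGreatest_le (P := fun x => D.Reachable x k) (n - 1)
      rcases le_or_gt x k with h3 | h3
      · exact hbelow x h1 h3
      · rcases h2.eq_or_lt with h4 | h4
        · rw [← h4] at hg
          exact hg
        · exact habove _ x hg h3 h4 (by omega)
  have hkc : k ≤ c := ((hc k hkn).1 (Reachable.refl _)).2
  refine ⟨min c (n - 1), by omega, by omega, hG, h0, ?_⟩
  intro x y hxy hlt
  have hx : x < n := hG.supp _ _ hxy
  have hy : y < n := hG.supp_right _ _ hxy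
  by_cases he : x = 0 ∧ y = k
  · exact Or.inl he
  have hDxy := (hDadj x y).2 ⟨hxy, by omega⟩
  have hiff : D.Reachable x k ↔ D.Reachable y k :=
    ⟨hDxy.symm.reachable.trans, hDxy.reachable.trans⟩
  rw [hc x hx, hc y hy] at hiff
  have : ¬ (0 < x ∧ x < k ∧ k < y) := fun h => hnc 0 k x y h0 hxy h.1 h.2.1 h.2.2
  omega

/-- The first neighbour of `0` in a tree that contains the edge `{0, k}` is `k`. -/
structure IsFirst (n k : ℕ) (G : SimpleGraph ℕ) : Prop where
  tree : IsNCTreeOn id (Set.Iio n) G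
  adj : G.Adj 0 k
  low : ∀ i, 1 ≤ i → i < k → ¬ G.Adj 0 i

theorem IsSplit.isFirst {n k c : ℕ} (hkc : k ≤ c) {G : SimpleGraph ℕ} (h : IsSplit n k c G) :
    IsFirst n k G := by
  refine ⟨h.tree, h.adj, fun i hi hik hadj => ?_⟩
  have := h.cases 0 i hadj (by omega)
  omega

/-- Trees with a given first edge `{0, k}` at `0`, sorted by the last vertex of the component
of `k` after deleting this edge. -/
noncomputable def firstEquiv {n k e : ℕ} (hk : 1 ≤ k) (hn : n = k + e) :
    (Σ d : Fin e, {G : SimpleGraph ℕ // IsSplit n k (k + d) G}) ≃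
      {G : SimpleGraph ℕ // IsFirst n k G} :=
  Equiv.ofBijective (fun P => ⟨P.2.1, P.2.2.isFirst (by omega)⟩) <| by
    constructor
    · rintro ⟨⟨d, hd⟩, ⟨G, h⟩⟩ ⟨⟨d', hd'⟩, ⟨G', h'⟩⟩ heq
      obtain rfl : G = G' := congrArg Subtype.val heq
      have h1 := h.le_of_isSplit hk (by simp) (by simp only; omega) h'
      have h2 := h'.le_of_isSplit hk (by simp) (by simp only; omega) h
      obtain rfl : d = d' := by simp only at h1 h2; omega
      rfl
    · rintro ⟨G, h⟩
      obtain ⟨c, hkc, hcn, hc⟩ := exists_isSplit hk h.tree h.adj h.low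
      obtain ⟨d, rfl⟩ := Nat.exists_eq_add_of_le hkc
      exact ⟨⟨⟨d, by omega⟩, ⟨G, hc⟩⟩, rfl⟩

/-- `G` is a noncrossing tree on `{0, …, n - 1}` where `0` has exactly one neighbour. -/
structure IsLeaf (n : ℕ) (G : SimpleGraph ℕ) : Prop where
  tree : IsNCTreeOn id (Set.Iio n) G
  leaf : ∃ k, ∀ x, G.Adj 0 x ↔ x = k

theorem IsSplit.adj_zero_iff {n k : ℕ} (hk : 1 ≤ k) {G : SimpleGraph ℕ}
    (h : IsSplit n k (n - 1) G) (x : ℕ) : G.Adj 0 x ↔ x = k := by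
  constructor
  · intro hx
    have hxn : x < n := h.tree.supp_right _ _ hx
    have := h.cases 0 x hx (Nat.pos_of_ne_zero hx.ne')
    omega
  · rintro rfl
    exact h.adj

theorem IsLeaf.exists_isSplit {n : ℕ} {G : SimpleGraph ℕ} (h : IsLeaf n G) :
    ∃ k, 1 ≤ k ∧ k < n ∧ IsSplit n k (n - 1) G := by
  obtain ⟨k, hk⟩ := h.leaf
  have h0 := (hk k).2 rfl
  have hkn : k < n := h.tree.supp_right _ _ h0
  refine ⟨k, Nat.pos_of_ne_zero h0.ne', hkn, h.tree, h0, fun x y hxy hlt => ?_⟩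
  have hy : y < n := h.tree.supp_right _ _ hxy
  have h1 := h.tree.nc 0 k x y h0 hxy
  simp only [id] at h1
  rcases Nat.eq_zero_or_pos x with rfl | hx
  · exact Or.inl ⟨rfl, (hk y).1 hxy⟩
  · omega

/-- Trees where `0` is a leaf, sorted by the neighbour of `0`. -/
noncomputable def leafEquiv (n : ℕ) :
    (Σ d : Fin (n - 1), {G : SimpleGraph ℕ // IsSplit n (d + 1) (n - 1) G}) ≃
      {G : SimpleGraph ℕ // IsLeaf n G} :=
  Equiv.ofBijective (fun P => ⟨P.2.1, P.2.2.tree, _, P.2.2.adj_zero_iff (by omega)⟩) <| by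
    constructor
    · rintro ⟨⟨d, hd⟩, ⟨G, h⟩⟩ ⟨⟨d', hd'⟩, ⟨G', h'⟩⟩ heq
      obtain rfl : G = G' := congrArg Subtype.val heq
      have h1 := (h.adj_zero_iff (by simp) _).1 h'.adj
      obtain rfl : d = d' := by simp only at h1; omega
      rfl
    · rintro ⟨G, h⟩
      obtain ⟨k, hk, hkn, hs⟩ := h.exists_isSplit
      obtain ⟨d, rfl⟩ := Nat.exists_eq_add_of_le' hk
      exact ⟨⟨⟨d, by omega⟩, ⟨G, hs⟩⟩, rfl⟩

instance : Unique (TreesOn (Set.Iio 1)) where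
  default := ⟨⊥, ⟨⟨by simp, ⟨0, by simp⟩, by
    simp only [Set.mem_Iio, Nat.lt_one_iff]
    rintro x rfl y rfl
    exact Reachable.refl _, by simp⟩, by simp⟩⟩
  uniq G := by
    apply Subtype.ext
    ext x y
    have h : ¬ G.1.Adj x y := by
      intro hxy
      have h1 := G.2.supp _ _ hxy
      have h2 := G.2.supp_right _ _ hxy
      simp only [Set.mem_Iio] at h1 h2
      exact hxy.ne (by omega)
    simp [h]

theorem A₁_eq (n : ℕ) [NeZero n] : A₁ n = Nat.card {G : SimpleGraph ℕ // IsLeaf n G} := by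
  refine Nat.card_congr ((zmodEquiv n _).trans (Equiv.subtypeEquivRight fun G => ?_))
  have hval : ∀ x, (pull ZMod.val Set.univ G : SimpleGraph (ZMod n)).Adj 0 x ↔ G.Adj 0 x.val := by
    intro x
    simp [pull]
  rw [Set.ncard_eq_one]
  constructor
  · rintro ⟨ht, a, ha⟩
    refine ⟨ht, a.val, fun x => ?_⟩
    have key : ∀ y : ZMod n, G.Adj 0 y.val ↔ y = a := fun y => by
      rw [← hval, ← mem_neighborSet, ha, Set.mem_singleton_iff]
    constructor
    · intro hx
      have hxn : x < n := ht.supp_right _ _ hx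
      rw [← ZMod.val_cast_of_lt hxn] at hx ⊢
      rw [(key _).1 hx]
    · rintro rfl
      exact (key a).2 rfl
  · rintro ⟨ht, k, hk⟩
    have hkn : k < n := ht.supp_right _ _ ((hk k).2 rfl)
    refine ⟨ht, (k : ZMod n), ?_⟩
    ext y
    rw [mem_neighborSet, hval, hk, Set.mem_singleton_iff]
    constructor
    · rintro rfl
      rw [ZMod.natCast_zmod_val]
    · rintro rfl
      exact ZMod.val_cast_of_lt hkn

/-- Trees with first edge `{0, k}` at `0` correspond to pairs of a tree on `k` vertices and a tree
with a leaf at `0`. -/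
noncomputable def firstLeafEquiv {n k m : ℕ} (hk : 1 ≤ k) (hm0 : 1 ≤ m) (hm : m + k = n + 1) :
    {G : SimpleGraph ℕ // IsFirst n k G} ≃
      TreesOn (Set.Iio k) × {G : SimpleGraph ℕ // IsLeaf m G} :=
  let split (d : Fin (m - 1)) : {G : SimpleGraph ℕ // IsSplit n k (k + d) G} ≃
      {G : SimpleGraph ℕ // IsSplit m (d + 1) (m - 1) G} × TreesOn (Set.Iio k) :=
    have hd := d.isLt
    ((splitEquivIio (q := d + 1) (r := m - 1 - d) hk (by omega) (by omega) (by omega)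
      (by omega)).trans (Equiv.prodComm _ _)).trans <| Equiv.prodCongr
    ((Equiv.prodCongr (Equiv.refl _) (Equiv.prodUnique _ (TreesOn (Set.Iio 1))).symm).trans
      (splitEquivIio (n := m) (by omega) (by omega) (by omega) (by omega) (by omega)).symm)
    (Equiv.refl _)
  (firstEquiv hk (e := m - 1) (by omega)).symm.trans <| (Equiv.sigmaCongrRight split).trans <|
    (Equiv.sigmaProdDistrib _ _).symm.trans <| (Equiv.prodComm _ _).trans <|
      Equiv.prodCongr (Equiv.refl _) (leafEquiv m)

end NCTree

theorem card_ncTrees_first_edge (n j : ℕ) (hn : 2 ≤ n) (hj2 : 2 ≤ j) (hjn : j ≤ n) :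
    Nat.card {G : SimpleGraph (ZMod n) //
        IsNCTree G ∧ G.Adj 0 ((j - 1 : ℕ) : ZMod n) ∧
        ∀ ℓ : ℕ, 2 ≤ ℓ → ℓ ≤ j - 1 → ¬ G.Adj 0 ((ℓ - 1 : ℕ) : ZMod n)} =
      A (j - 1) * A₁ (n + 2 - j) := by
  have : NeZero n := ⟨by omega⟩
  have : NeZero (j - 1) := ⟨by omega⟩
  have : NeZero (n + 2 - j) := ⟨by omega⟩
  rw [NCTree.A_eq, NCTree.A₁_eq, ← Nat.card_prod]
  refine Nat.card_congr ((NCTree.zmodEquiv n _).trans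
    ((Equiv.subtypeEquivRight fun G => ?_).trans
      (NCTree.firstLeafEquiv (n := n) (by omega) (by omega) (by omega))))
  have hval : ∀ i < n, (NCTree.pull ZMod.val Set.univ G : SimpleGraph (ZMod n)).Adj 0 (i : ZMod n) ↔
      G.Adj 0 i := by
    intro i hi
    simp [NCTree.pull, ZMod.val_cast_of_lt hi]
  constructor
  · rintro ⟨ht, h0, hlow⟩
    refine ⟨ht, (hval _ (by omega)).1 h0, fun i hi hij hadj => ?_⟩
    exact hlow (i + 1) (by omega) (by omega) ((hval i (by omega)).2 hadj)
  · rintro ⟨ht, h0, hlow⟩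
    refine ⟨ht, (hval _ (by omega)).2 h0, fun l hl hlj hadj => ?_⟩
    exact hlow (l - 1) (by omega) (by omega) ((hval _ (by omega)).1 hadj)
end
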